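/- Let (Ω, F, P) be a probability space, B = [a,b] ⊆ ℝ a finite closed interval, p ∈ [1, ∞), and let x : ℝ → ℝ be bounded, continuous on B and nonincreasing on B. For each n, let x_n : Ω × ℝ → ℝ be such that x_n(ω, ·) is bounded and Borel-measurable for each ω, and such that ω ↦ (∫_B |x_n(ω,t) − x(t)|^p dt)^{1/p} is measurable. If for every ε > 0, P((∫_B |x_n(·,t) − x(t)|^p dt)^{1/p} > ε) → 0 as n → ∞, then the same holds for the monotonized estimator: for every ε > 0, P((∫_B |T_B(x_n(·, ·))(t) − x(t)|^p dt)^{1/p} > ε) → 0 as n → ∞. -/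

import Mathlib

open MeasureTheory Set Filter

/-- The upper level set function `r_{f,I}(u) = λ{t ∈ I : f t > u}`. -/
noncomputable def upperLevel (f : ℝ → ℝ) (I : Set ℝ) (u : ℝ) : ℝ :=
  (volume {t | t ∈ I ∧ u < f t}).toReal

/-- The monotone rearrangement `T_I(f)(t) = inf{u ∈ f(I) : r_{f,I}(u) ≤ t - inf I}`. -/
noncomputable def monoRearr (f : ℝ → ℝ) (I : Set ℝ) (t : ℝ) : ℝ :=
  sInf {u | u ∈ f '' I ∧ upperLevel f I u ≤ t - sInf I}

/-- A `p`-th power as a one-dimensional layer-cake integral. -/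
lemma ofReal_posPart_sub_rpow_eq_lintegral {p : ℝ} (hp : 1 ≤ p) (y z : ℝ) :
    ENNReal.ofReal (max (y - z) 0 ^ p) =
      ENNReal.ofReal p *
        ∫⁻ u, (Ico z y).indicator (fun u => ENNReal.ofReal ((y - u) ^ (p - 1))) u := by
  have h := lintegral_rpow_eq_lintegral_meas_le_mul (μ := Measure.dirac ())
    (f := fun _ => max (y - z) 0) (ae_of_all _ fun _ => le_max_right _ _)
    aemeasurable_const (p := p) (by linarith)
  rw [lintegral_dirac] at h
  rw [h]
  congr 1
  rw [← lintegral_sub_left_eq_self ((Ico z y).indicator _) y,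
    ← lintegral_indicator measurableSet_Ioi]
  refine lintegral_congr fun t => ?_
  by_cases ht : 0 < t
  · by_cases hty : t ≤ y - z
    · have : y - t ∈ Ico z y := ⟨by linarith, by linarith⟩
      simp [indicator, ht, hty, this]
    · have : y - t ∉ Ico z y := fun h => hty (by linarith [h.1])
      simp [indicator, ht, hty, this, not_le.2 ht]
  · have : y - t ∉ Ico z y := fun h => ht (by linarith [h.2])
    simp [indicator, ht, this]

/-- Stochastic dominance for the truncated powers `(y - u)₊ ^ q`. -/
lemma lintegral_truncated_rpow_le {α : Type*} [MeasurableSpace α] {μ : Measure α}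
    {F f : α → ℝ} (hF : Measurable F) (hf : Measurable f)
    (h : ∀ v, μ {t | v < F t} ≤ μ {t | v < f t}) {q : ℝ} (hq : 0 ≤ q) (u : ℝ) :
    ∫⁻ t, {t | u < F t}.indicator (fun t => ENNReal.ofReal ((F t - u) ^ q)) t ∂μ ≤
      ∫⁻ t, {t | u < f t}.indicator (fun t => ENNReal.ofReal ((f t - u) ^ q)) t ∂μ := by
  rcases hq.eq_or_lt with rfl | hq
  · simp only [Real.rpow_zero, ENNReal.ofReal_one]
    rw [lintegral_indicator_const (measurableSet_lt measurable_const hF),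
      lintegral_indicator_const (measurableSet_lt measurable_const hf)]
    simpa using h u
  · have key : ∀ {G : α → ℝ}, Measurable G →
        ∫⁻ t, {t | u < G t}.indicator (fun t => ENNReal.ofReal ((G t - u) ^ q)) t ∂μ =
          ENNReal.ofReal q *
            ∫⁻ s in Ioi 0, μ {t | u + s < G t} * ENNReal.ofReal (s ^ (q - 1)) := by
      intro G hG
      have e := lintegral_rpow_eq_lintegral_meas_lt_mul μ
        (f := fun t => max (G t - u) 0) (ae_of_all _ fun _ => le_max_right _ _)
        (by fun_prop) hq
      convert e using 1
      · refine lintegral_congr fun t => ?_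
        by_cases ht : u < G t
        · simp [indicator, ht, max_eq_left (sub_nonneg.2 ht.le)]
        · simp [indicator, ht, max_eq_right (sub_nonpos.2 (not_lt.1 ht)), Real.zero_rpow hq.ne']
      · congr 1
        refine setLIntegral_congr_fun measurableSet_Ioi fun s hs => ?_
        congr 3
        ext t
        have hs0 : 0 < s := hs
        simp [lt_sub_iff_add_lt', hs0.le.not_gt]
    rw [key hF, key hf]
    gcongr ENNReal.ofReal q * ?_
    exact lintegral_mono fun s => mul_le_mul_left (h _) _

/-- Comparison of `L^p` norms of positive parts from joint tail dominance. -/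
lemma lintegral_posPart_sub_rpow_le {α : Type*} [MeasurableSpace α] {μ : Measure α} [SFinite μ]
    {x F f : α → ℝ} (hx : Measurable x) (hF : Measurable F) (hf : Measurable f)
    (h : ∀ u v, μ ({t | x t ≤ u} ∩ {t | v < F t}) ≤ μ ({t | x t ≤ u} ∩ {t | v < f t}))
    {p : ℝ} (hp : 1 ≤ p) :
    ∫⁻ t, ENNReal.ofReal (max (F t - x t) 0 ^ p) ∂μ ≤
      ∫⁻ t, ENNReal.ofReal (max (f t - x t) 0 ^ p) ∂μ := by
  have key : ∀ {G : α → ℝ}, Measurable G →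
      ∫⁻ t, ENNReal.ofReal (max (G t - x t) 0 ^ p) ∂μ =
        ENNReal.ofReal p * ∫⁻ u, ∫⁻ t, {t | u < G t}.indicator
          (fun t => ENNReal.ofReal ((G t - u) ^ (p - 1))) t ∂(μ.restrict {t | x t ≤ u}) := by
    intro G hG
    simp only [ofReal_posPart_sub_rpow_eq_lintegral hp]
    have hset : MeasurableSet {z : α × ℝ | x z.1 ≤ z.2 ∧ z.2 < G z.1} :=
      (measurableSet_le (hx.comp measurable_fst) measurable_snd).inter
        (measurableSet_lt measurable_snd (hG.comp measurable_fst))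
    have hmeas : Measurable (Function.uncurry fun (t : α) (u : ℝ) =>
        (Ico (x t) (G t)).indicator (fun u => ENNReal.ofReal ((G t - u) ^ (p - 1))) u) :=
      Measurable.indicator (f := fun z : α × ℝ => ENNReal.ofReal ((G z.1 - z.2) ^ (p - 1)))
        (by fun_prop) hset
    rw [lintegral_const_mul' _ _ ENNReal.ofReal_ne_top, lintegral_lintegral_swap hmeas.aemeasurable]
    congr 1
    refine lintegral_congr fun u => ?_
    rw [← lintegral_indicator (measurableSet_le hx measurable_const)]
    refine lintegral_congr fun t => ?_
    by_cases h1 : x t ≤ u <;> by_cases h2 : u < G t <;> simp [indicator, h1, h2]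
  rw [key hF, key hf]
  gcongr ENNReal.ofReal p * ?_
  refine lintegral_mono fun u => ?_
  refine lintegral_truncated_rpow_le hF hf (fun v => ?_) (by linarith) u
  rw [Measure.restrict_apply (measurableSet_lt measurable_const hF),
    Measure.restrict_apply (measurableSet_lt measurable_const hf), inter_comm,
    inter_comm {t | v < f t}]
  exact h u v

/-- Equally large sets, one of which fills the complement of `U`, compare inside `U`. -/
lemma measure_inter_le_of_diff_subset {α : Type*} [MeasurableSpace α] {μ : Measure α}
    {U A E : Set α} (hU : MeasurableSet U) (hA : μ A ≠ ⊤) (hAE : μ A ≤ μ E)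
    (hsub : E \ U ⊆ A) : μ (U ∩ A) ≤ μ (U ∩ E) := by
  have h1 := measure_inter_add_sdiff (μ := μ) A hU
  have h2 := measure_inter_add_sdiff (μ := μ) E hU
  have h3 : μ (E \ U) ≤ μ (A \ U) := measure_mono fun t ht => ⟨hsub ht, ht.2⟩
  have h4 : μ (A \ U) ≠ ⊤ := ne_top_of_le_ne_top hA (measure_mono sdiff_subset)
  rw [inter_comm U, inter_comm U]
  refine (ENNReal.add_le_add_iff_right h4).1 ?_
  calc μ (A ∩ U) + μ (A \ U) = μ A := h1
    _ ≤ μ E := hAE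
    _ = μ (E ∩ U) + μ (E \ U) := h2.symm
    _ ≤ μ (E ∩ U) + μ (A \ U) := by gcongr

lemma ofReal_upperLevel (f : ℝ → ℝ) (a b u : ℝ) :
    ENNReal.ofReal (upperLevel f (Icc a b) u) = volume (Icc a b ∩ {t | u < f t}) :=
  ENNReal.ofReal_toReal (measure_ne_top_of_subset (fun _ ht => ht.1) (by simp))

lemma upperLevel_antitone (f : ℝ → ℝ) (a b : ℝ) : Antitone (upperLevel f (Icc a b)) := by
  intro u v huv
  refine ENNReal.toReal_mono (measure_ne_top_of_subset (fun _ ht => ht.1) (by simp)) ?_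
  exact measure_mono fun t ht => ⟨ht.1, huv.trans_lt ht.2⟩

/-- Levels with small upper level sets are approximated from below by attained values. -/
lemma exists_value_le_of_upperLevel_lt {f : ℝ → ℝ} (hf : Measurable f) {a b : ℝ} (hab : a ≤ b)
    {u s : ℝ} (hs : s ≤ b - a) (h : upperLevel f (Icc a b) u < s) :
    ∃ v ∈ f '' Icc a b, v ≤ u ∧ upperLevel f (Icc a b) v ≤ s := by
  by_contra! hcon
  set A := f '' Icc a b ∩ Iic u with hA
  have hne : A.Nonempty := by
    by_contra hemp
    have : {t | t ∈ Icc a b ∧ u < f t} = Icc a b := by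
      ext t
      refine ⟨fun ht => ht.1, fun ht => ⟨ht, ?_⟩⟩
      by_contra hle
      exact hemp ⟨f t, ⟨t, ht, rfl⟩, not_lt.1 hle⟩
    rw [upperLevel, this, Real.volume_Icc, ENNReal.toReal_ofReal (by linarith)] at h
    linarith
  have hbdd : BddAbove A := ⟨u, fun v hv => hv.2⟩
  have hset : ∀ t ∈ Icc a b, sSup A < f t → u < f t := fun t ht hlt => by
    by_contra hle
    exact hlt.not_ge (le_csSup hbdd ⟨⟨t, ht, rfl⟩, not_lt.1 hle⟩)
  have hSu : sSup A ≤ u := csSup_le hne fun v hv => hv.2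
  by_cases hmem : sSup A ∈ A
  · have := hcon _ hmem.1 hSu
    have h2 : upperLevel f (Icc a b) (sSup A) ≤ upperLevel f (Icc a b) u :=
      ENNReal.toReal_mono (measure_ne_top_of_subset (fun _ ht => ht.1) (by simp))
        (measure_mono fun t ht => ⟨ht.1, hset t ht.1 ht.2⟩)
    linarith
  · obtain ⟨w, hwmono, hwlim, hwA⟩ := exists_seq_tendsto_sSup hne hbdd
    have hanti : Antitone fun n => Icc a b ∩ {t | w n < f t} := fun m n hmn t ht =>
      ⟨ht.1, (hwmono hmn).trans_lt ht.2⟩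
    have hInter : ⋂ n, Icc a b ∩ {t | w n < f t} ⊆ Icc a b ∩ {t | u < f t} := by
      intro t ht
      rw [mem_iInter] at ht
      have ht0 : t ∈ Icc a b := (ht 0).1
      have hle : sSup A ≤ f t := le_of_tendsto' hwlim fun n => le_of_lt (ht n).2
      refine ⟨ht0, ?_⟩
      rcases hle.eq_or_lt with he | hlt
      · by_contra hnu
        exact hmem ⟨he ▸ ⟨t, ht0, rfl⟩, hSu⟩
      · exact hset t ht0 hlt
    have hmeas := hanti.measure_iInter (μ := volume)
      (fun n => (measurableSet_Icc.inter (measurableSet_lt measurable_const hf)).nullMeasurableSet)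
      ⟨0, measure_ne_top_of_subset (fun _ ht => ht.1) (by simp)⟩
    have hge : ENNReal.ofReal s ≤ ENNReal.ofReal (upperLevel f (Icc a b) u) := by
      rw [ofReal_upperLevel]
      refine le_trans ?_ (measure_mono hInter)
      rw [hmeas]
      refine le_iInf fun n => ?_
      rw [← ofReal_upperLevel]
      exact ENNReal.ofReal_le_ofReal (hcon _ (hwA n).1 (hwA n).2).le
    have h0 : 0 ≤ upperLevel f (Icc a b) u := ENNReal.toReal_nonneg
    exact (ENNReal.ofReal_le_ofReal_iff h0).1 hge |>.not_gt h

section Rearrangement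

variable {f : ℝ → ℝ} {a b M t u : ℝ}

lemma bddBelow_monoRearr_set (hM : ∀ t, |f t| ≤ M) (I : Set ℝ) (t : ℝ) :
    BddBelow {u | u ∈ f '' I ∧ upperLevel f I u ≤ t - sInf I} := by
  refine ⟨-M, ?_⟩
  rintro _ ⟨⟨s, -, rfl⟩, -⟩
  exact (abs_le.1 (hM s)).1

lemma monoRearr_le_of_upperLevel_lt (hf : Measurable f) (hM : ∀ t, |f t| ≤ M)
    (ht : t ∈ Ioc a b) (h : upperLevel f (Icc a b) u < t - a) :
    monoRearr f (Icc a b) t ≤ u := by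
  have hab : a ≤ b := ht.1.le.trans ht.2
  obtain ⟨v, hv, hvu, hvt⟩ :=
    exists_value_le_of_upperLevel_lt hf hab (by linarith [ht.2] : t - a ≤ b - a) h
  exact (csInf_le (bddBelow_monoRearr_set hM _ _) ⟨hv, by rwa [csInf_Icc hab]⟩).trans hvu

lemma monoRearr_set_nonempty (hf : Measurable f) (hM : ∀ t, |f t| ≤ M) (ht : t ∈ Ioc a b) :
    {u | u ∈ f '' Icc a b ∧ upperLevel f (Icc a b) u ≤ t - sInf (Icc a b)}.Nonempty := by
  have hab : a ≤ b := ht.1.le.trans ht.2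
  have h0 : upperLevel f (Icc a b) M = 0 := by
    have : {t | t ∈ Icc a b ∧ M < f t} = ∅ :=
      eq_empty_of_forall_notMem fun s hs => hs.2.not_ge (abs_le.1 (hM s)).2
    rw [upperLevel, this, measure_empty, ENNReal.toReal_zero]
  obtain ⟨v, hv, -, hvt⟩ :=
    exists_value_le_of_upperLevel_lt (s := t - a) (u := M) hf hab (by linarith [ht.2])
      (by linarith [ht.1])
  exact ⟨v, hv, by rwa [csInf_Icc hab]⟩

lemma lt_monoRearr_of_lt_upperLevel (hf : Measurable f) (hM : ∀ t, |f t| ≤ M)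
    (ht : t ∈ Ioc a b) (h : t - a < upperLevel f (Icc a b) u) :
    u < monoRearr f (Icc a b) t := by
  have hab : a ≤ b := ht.1.le.trans ht.2
  by_contra! hle
  have hmono : Monotone fun n : ℕ => Icc a b ∩ {s | u + 1 / ((n : ℝ) + 1) < f s} :=
    fun m n hmn s hs =>
      ⟨hs.1, lt_of_le_of_lt (add_le_add_right (Nat.one_div_le_one_div hmn) u) hs.2⟩
  have hUnion : Icc a b ∩ {s | u < f s} ⊆
      ⋃ n : ℕ, Icc a b ∩ {s | u + 1 / ((n : ℝ) + 1) < f s} := by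
    intro s hs
    have hlt : u < f s := hs.2
    obtain ⟨n, hn⟩ := exists_nat_one_div_lt (sub_pos.2 hlt)
    exact mem_iUnion.2 ⟨n, hs.1, by simpa [lt_sub_iff_add_lt'] using hn⟩
  have hsup : ENNReal.ofReal (upperLevel f (Icc a b) u) ≤ ENNReal.ofReal (t - a) := by
    rw [ofReal_upperLevel]
    refine (measure_mono hUnion).trans ?_
    rw [hmono.measure_iUnion]
    refine iSup_le fun n => ?_
    have hpos : (0 : ℝ) < 1 / ((n : ℝ) + 1) := by positivity
    obtain ⟨v, hv, hvlt⟩ := exists_lt_of_csInf_lt (monoRearr_set_nonempty hf hM ht)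
      (lt_of_le_of_lt hle (lt_add_of_pos_right u hpos))
    rw [← ofReal_upperLevel]
    refine ENNReal.ofReal_le_ofReal ((upperLevel_antitone f a b hvlt.le).trans ?_)
    simpa [csInf_Icc hab] using hv.2
  exact h.not_ge ((ENNReal.ofReal_le_ofReal_iff (by linarith [ht.1])).1 hsup)

lemma antitoneOn_monoRearr (hf : Measurable f) (hM : ∀ t, |f t| ≤ M) :
    AntitoneOn (monoRearr f (Icc a b)) (Ioc a b) := fun s hs t _ hst =>
  csInf_le_csInf (bddBelow_monoRearr_set hM _ _) (monoRearr_set_nonempty hf hM hs)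
    fun _ hv => ⟨hv.1, hv.2.trans (by linarith)⟩

lemma volume_restrict_lt (f : ℝ → ℝ) (a b u : ℝ) :
    volume.restrict (Ioc a b) {t | u < f t} = ENNReal.ofReal (upperLevel f (Icc a b) u) := by
  rw [ofReal_upperLevel, restrict_Ioc_eq_restrict_Icc, Measure.restrict_apply' measurableSet_Icc,
    inter_comm]

/-- Tail dominance on the lower level sets of a nonincreasing function. -/
lemma measure_inter_lt_monoRearr_le (hf : Measurable f) (hM : ∀ t, |f t| ≤ M)
    {U : Set ℝ} (hU : IsUpperSet U) (hUm : MeasurableSet U) (v : ℝ) :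
    volume.restrict (Ioc a b) (U ∩ {t | v < monoRearr f (Icc a b) t}) ≤
      volume.restrict (Ioc a b) (U ∩ {t | v < f t}) := by
  set r := upperLevel f (Icc a b) v with hr
  have hr0 : 0 ≤ r := ENNReal.toReal_nonneg
  set μ := volume.restrict (Ioc a b) with hμ
  have hsub : μ (U ∩ {t | v < monoRearr f (Icc a b) t}) ≤ μ (U ∩ Iic (a + r)) := by
    refine measure_mono_ae ?_
    filter_upwards [ae_restrict_mem measurableSet_Ioc] with t ht htv
    refine ⟨htv.1, ?_⟩
    by_contra hlt
    simp only [mem_Iic, not_le] at hlt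
    exact (monoRearr_le_of_upperLevel_lt hf hM ht (by linarith)).not_gt htv.2
  refine hsub.trans ?_
  by_cases hex : ∃ t ∈ U, t ≤ a + r
  · obtain ⟨t, htU, ht⟩ := hex
    refine measure_inter_le_of_diff_subset hUm (measure_ne_top _ _) ?_ ?_
    · rw [volume_restrict_lt, Measure.restrict_apply measurableSet_Iic]
      refine (measure_mono (t := Icc a (a + r)) fun s hs => ⟨hs.2.1.le, hs.1⟩).trans ?_
      simp [hr]
    · intro s hs
      by_contra hlt
      exact hs.2 (hU (ht.trans (not_le.1 hlt).le) htU)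
  · have : U ∩ Iic (a + r) = ∅ := eq_empty_of_forall_notMem fun t ht => hex ⟨t, ht⟩
    simp [this]

/-- Lower tail dominance on the upper level sets of a nonincreasing function. -/
lemma measure_inter_monoRearr_le_le (hf : Measurable f) (hM : ∀ t, |f t| ≤ M)
    {L : Set ℝ} (hL : IsLowerSet L) (hLm : MeasurableSet L) (v : ℝ) :
    volume.restrict (Ioc a b) (L ∩ {t | monoRearr f (Icc a b) t ≤ v}) ≤
      volume.restrict (Ioc a b) (L ∩ {t | f t ≤ v}) := by
  set r := upperLevel f (Icc a b) v with hr
  have hr0 : 0 ≤ r := ENNReal.toReal_nonneg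
  set μ := volume.restrict (Ioc a b) with hμ
  have hsub : μ (L ∩ {t | monoRearr f (Icc a b) t ≤ v}) ≤ μ (L ∩ Ici (a + r)) := by
    refine measure_mono_ae ?_
    filter_upwards [ae_restrict_mem measurableSet_Ioc] with t ht htv
    refine ⟨htv.1, ?_⟩
    by_contra hlt
    simp only [mem_Ici, not_le] at hlt
    exact (lt_monoRearr_of_lt_upperLevel hf hM ht (by linarith)).not_ge htv.2
  refine hsub.trans ?_
  by_cases hex : ∃ t ∈ L, a + r ≤ t
  · obtain ⟨t, htL, ht⟩ := hex
    refine measure_inter_le_of_diff_subset hLm (measure_ne_top _ _) ?_ ?_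
    · have hcompl : {t | f t ≤ v} = {t | v < f t}ᶜ := by ext; simp
      rw [hcompl, measure_compl (measurableSet_lt measurable_const hf) (measure_ne_top _ _),
        volume_restrict_lt, Measure.restrict_apply measurableSet_Ici, hμ,
        Measure.restrict_apply_univ, Real.volume_Ioc, ← ENNReal.ofReal_sub _ hr0]
      refine (measure_mono (t := Icc (a + r) b) fun s hs => ⟨hs.1, hs.2.2⟩).trans ?_
      rw [Real.volume_Icc, sub_add_eq_sub_sub]
    · intro s hs
      by_contra hlt
      exact hs.2 (hL ((not_le.1 hlt).le.trans ht) htL)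
  · have : L ∩ Ici (a + r) = ∅ := eq_empty_of_forall_notMem fun t ht => hex ⟨t, ht⟩
    simp [this]

lemma measure_inter_monoRearr_lt_le (hf : Measurable f) (hM : ∀ t, |f t| ≤ M)
    {L : Set ℝ} (hL : IsLowerSet L) (hLm : MeasurableSet L) (v : ℝ) :
    volume.restrict (Ioc a b) (L ∩ {t | monoRearr f (Icc a b) t < v}) ≤
      volume.restrict (Ioc a b) (L ∩ {t | f t < v}) := by
  have hmono : Monotone fun n : ℕ =>
      L ∩ {s | monoRearr f (Icc a b) s ≤ v - 1 / ((n : ℝ) + 1)} :=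
    fun m n hmn s hs =>
      ⟨hs.1, le_trans hs.2 (sub_le_sub_left (Nat.one_div_le_one_div hmn) v)⟩
  have hUnion : L ∩ {s | monoRearr f (Icc a b) s < v} ⊆
      ⋃ n : ℕ, L ∩ {s | monoRearr f (Icc a b) s ≤ v - 1 / ((n : ℝ) + 1)} := by
    intro s hs
    have hlt : monoRearr f (Icc a b) s < v := hs.2
    obtain ⟨n, hn⟩ := exists_nat_one_div_lt (sub_pos.2 hlt)
    exact mem_iUnion.2 ⟨n, hs.1, le_sub_comm.1 hn.le⟩
  refine (measure_mono hUnion).trans ?_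
  rw [hmono.measure_iUnion]
  refine iSup_le fun n => (measure_inter_monoRearr_le_le hf hM hL hLm _).trans ?_
  refine measure_mono fun s hs => ⟨hs.1, ?_⟩
  have hpos : (0 : ℝ) < 1 / ((n : ℝ) + 1) := by positivity
  exact (show f s ≤ v - 1 / ((n : ℝ) + 1) from hs.2).trans_lt (sub_lt_self v hpos)

end Rearrangement

lemma ofReal_abs_rpow_eq_add {p : ℝ} (hp : 0 < p) (d : ℝ) :
    ENNReal.ofReal (|d| ^ p) =
      ENNReal.ofReal (max d 0 ^ p) + ENNReal.ofReal (max (-d) 0 ^ p) := by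
  rcases le_total 0 d with h | h
  · simp [abs_of_nonneg h, h, Real.zero_rpow hp.ne']
  · simp [abs_of_nonpos h, h, Real.zero_rpow hp.ne']

/-- Monotone rearrangement does not increase the `L^p` distance to a nonincreasing function. -/
lemma lintegral_abs_monoRearr_sub_rpow_le {f x : ℝ → ℝ} {a b M p : ℝ} (hf : Measurable f)
    (hM : ∀ t, |f t| ≤ M) (hx : Antitone x) (hp : 1 ≤ p) :
    ∫⁻ t in Ioc a b, ENNReal.ofReal (|monoRearr f (Icc a b) t - x t| ^ p) ≤
      ∫⁻ t in Ioc a b, ENNReal.ofReal (|f t - x t| ^ p) := by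
  have hF : AEMeasurable (monoRearr f (Icc a b)) (volume.restrict (Ioc a b)) :=
    aemeasurable_restrict_of_antitoneOn measurableSet_Ioc (antitoneOn_monoRearr hf hM)
  have hxm : Measurable x := hx.measurable
  have hp0 : 0 < p := by linarith
  have hneg : ∀ y z : ℝ, -(y - z) = -y - -z := fun y z => by ring
  have hae := hF.ae_eq_mk
  rw [lintegral_congr_ae (hae.mono fun t ht => by rw [ht])]
  set G := hF.mk with hGdef
  have hG : Measurable G := hF.measurable_mk
  simp only [ofReal_abs_rpow_eq_add hp0, hneg]
  rw [lintegral_add_left (by fun_prop), lintegral_add_left (by fun_prop)]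
  refine add_le_add
    (lintegral_posPart_sub_rpow_le hxm hG hf (fun u v => ?_) hp)
    (lintegral_posPart_sub_rpow_le hxm.neg hG.neg hf.neg (fun u v => ?_) hp)
  · refine le_trans (measure_mono_ae ?_) (measure_inter_lt_monoRearr_le hf hM
      (U := {t | x t ≤ u}) (fun s t hst hs => (hx hst).trans hs)
      (measurableSet_le hxm measurable_const) v)
    filter_upwards [hae] with t ht h
    exact ⟨h.1, (show v < G t from h.2).trans_eq ht.symm⟩
  · refine le_trans (measure_mono_ae ?_) ((measure_inter_monoRearr_lt_le hf hM
      (L := {t | -u ≤ x t}) (fun s t hst hs => le_trans hs (hx hst))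
      (measurableSet_le measurable_const hxm) (-v)).trans (measure_mono fun t ht => ?_))
    · filter_upwards [hae] with t ht h
      have h1 : -x t ≤ u := h.1
      have h2 : v < -G t := h.2
      exact ⟨neg_le.1 h1, ht.trans_lt (lt_neg_of_lt_neg h2)⟩
    · have h1 : -u ≤ x t := ht.1
      have h2 : f t < -v := ht.2
      exact ⟨neg_le.1 h1, lt_neg_of_lt_neg h2⟩

lemma integral_abs_monoRearr_sub_rpow_le {f x : ℝ → ℝ} {a b M N p : ℝ} (hf : Measurable f)
    (hM : ∀ t, |f t| ≤ M) (hxN : ∀ t, |x t| ≤ N) (hx : AntitoneOn x (Icc a b)) (hab : a ≤ b)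
    (hp : 1 ≤ p) :
    ∫ t in Icc a b, |monoRearr f (Icc a b) t - x t| ^ p ≤
      ∫ t in Icc a b, |f t - x t| ^ p := by
  set y : ℝ → ℝ := fun t => x (max a (min b t)) with hy
  have hy_anti : Antitone y := fun s t hst =>
    hx ⟨le_max_left _ _, max_le hab (min_le_left _ _)⟩
      ⟨le_max_left _ _, max_le hab (min_le_left _ _)⟩ (by gcongr)
  have hyx : ∀ t ∈ Ioc a b, x t = y t := fun t ht => by
    simp [hy, min_eq_right ht.2, max_eq_right ht.1.le]
  have hF : AEMeasurable (monoRearr f (Icc a b)) (volume.restrict (Ioc a b)) :=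
    aemeasurable_restrict_of_antitoneOn measurableSet_Ioc (antitoneOn_monoRearr hf hM)
  have hym : Measurable y := hy_anti.measurable
  have key : ∀ {g : ℝ → ℝ}, AEMeasurable g (volume.restrict (Ioc a b)) →
      ∫ t in Icc a b, |g t - x t| ^ p =
        (∫⁻ t in Ioc a b, ENNReal.ofReal (|g t - y t| ^ p)).toReal := by
    intro g hg
    rw [integral_Icc_eq_integral_Ioc, setIntegral_congr_fun
      (g := fun t => |g t - y t| ^ p) measurableSet_Ioc fun t ht => by simp only [hyx t ht]]
    exact integral_eq_lintegral_of_nonneg_ae (ae_of_all _ fun t => by positivity)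
      (AEMeasurable.aestronglyMeasurable (by fun_prop))
  rw [key hF, key hf.aemeasurable]
  refine ENNReal.toReal_mono (ne_top_of_le_ne_top
    (b := ∫⁻ _ in Ioc a b, ENNReal.ofReal ((M + N) ^ p)) ?_ (lintegral_mono fun t => ?_))
    (lintegral_abs_monoRearr_sub_rpow_le hf hM hy_anti hp)
  · rw [lintegral_const]
    exact ENNReal.mul_ne_top ENNReal.ofReal_ne_top (measure_ne_top _ _)
  · refine ENNReal.ofReal_le_ofReal (Real.rpow_le_rpow (abs_nonneg _) ?_ (by linarith))
    exact (abs_sub _ _).trans (add_le_add (hM _) (hxN _))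

/-- If the estimators `x_n` converge to a bounded, continuous, nonincreasing
`x` in `L^p` norm over `B = [a,b]` in probability, then so do the monotonized estimators
`T_B(x_n)`. -/
theorem monoRearr_Lp_consistent
    {Ω : Type*} [MeasurableSpace Ω] (P : Measure Ω) [IsProbabilityMeasure P]
    (a b : ℝ) (hab : a ≤ b) (p : ℝ) (hp : 1 ≤ p) (x : ℝ → ℝ)
    (hxb : ∃ M, ∀ t, |x t| ≤ M)
    (hxc : ContinuousOn x (Icc a b))
    (hxm : AntitoneOn x (Icc a b))
    (xn : ℕ → Ω → ℝ → ℝ)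
    (hxnm : ∀ n ω, Measurable (xn n ω))
    (hxnb : ∀ n ω, ∃ M, ∀ t, |xn n ω t| ≤ M)
    (hLpmeas : ∀ n,
      Measurable (fun ω => (∫ t in Icc a b, |xn n ω t - x t| ^ p) ^ (1 / p)))
    (hcons : ∀ ε > (0 : ℝ),
      Tendsto (fun n =>
        (P {ω | ε < (∫ t in Icc a b, |xn n ω t - x t| ^ p) ^ (1 / p)}).toReal)
        atTop (nhds 0)) :
    ∀ ε > (0 : ℝ),
      Tendsto (fun n =>
        (P {ω | ε < (∫ t in Icc a b,
          |monoRearr (xn n ω) (Icc a b) t - x t| ^ p) ^ (1 / p)}).toReal)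
        atTop (nhds 0) := by
  intro ε hε
  obtain ⟨N, hN⟩ := hxb
  refine squeeze_zero (fun _ => ENNReal.toReal_nonneg) (fun n => ?_) (hcons ε hε)
  refine ENNReal.toReal_mono (measure_ne_top _ _) (measure_mono fun ω hω => ?_)
  obtain ⟨M, hM⟩ := hxnb n ω
  refine lt_of_lt_of_le hω (Real.rpow_le_rpow ?_ ?_ (by positivity))
  · exact integral_nonneg fun t => by positivity
  · exact integral_abs_monoRearr_sub_rpow_le (hxnm n ω) hM hN hxm hab hp
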